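/- For every n ≥ 2, D^n_{a,b} = Σ a^{r(t)}·b^{l(t)}·T(σ) in ℤ[a,b][S_n], where the sum is over all complete binary trees T with n leaves and all admissible labellings σ of T, t is the binary tree formed by the internal nodes of T, and r(t), l(t) are its numbers of right and left edges. -/

import Mathlib

/-- The free module on words of positive integers, with coefficients in `R`.
`ℚ[S_n]` is identified with the span of the permutation words of {1,…,n}. -/
abbrev FW (R : Type) [CommRing R] := (List ℕ) →₀ R

variable {R : Type} [CommRing R]

/-- Concatenation product, extended bilinearly. -/
noncomputable def catW (x y : FW R) : FW R :=
  x.sum fun u a => y.sum fun v b => Finsupp.single (u ++ v) (a * b)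

/-- The bracket [x,y] = x·y − y·x of the concatenation product. -/
noncomputable def brakW (x y : FW R) : FW R := catW x y - catW y x

/-- (Incomplete) binary trees; `nil` is the empty tree. The complete binary tree with
`t.nodes + 1` leaves whose internal nodes form `t` is implicit in the definitions below. -/
inductive BT
  | nil : BT
  | nd : BT → BT → BT
deriving DecidableEq

/-- Number of nodes of a binary tree. -/
def BT.nodes : BT → ℕ
  | .nil => 0
  | .nd l r => l.nodes + r.nodes + 1

/-- The evaluation T(σ) of the complete binary tree `T` whose internal nodes form `t`, with
leaves labelled left to right by the word `w`: each leaf gets the one-letter word of its label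
and each internal node the bracket of concatenation. -/
noncomputable def evalBT : BT → List ℕ → FW R
  | .nil, w => Finsupp.single w 1
  | .nd l r, w => brakW (evalBT l (w.take (l.nodes + 1))) (evalBT r (w.drop (l.nodes + 1)))

/-- The standardization of a word with distinct letters: each letter is replaced by its rank. -/
def stdW (w : List ℕ) : List ℕ := w.map fun x => (w.filter (· ≤ x)).length

/-- The set of permutation words of {1, …, n}. -/
def permWords (n : ℕ) : Finset (List ℕ) := (List.range' 1 n).permutations.toFinset

/-- Convolution α⋆β of two permutation words: the sum of all permutation words γ of size
|α|+|β| with std(γ(1)⋯γ(m)) = α and std(γ(m+1)⋯γ(m+n)) = β. -/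
noncomputable def convW (u v : List ℕ) : FW R :=
  ∑ γ ∈ (permWords (u.length + v.length)).filter
      (fun γ => stdW (γ.take u.length) = u ∧ stdW (γ.drop u.length) = v),
    Finsupp.single γ 1

/-- The convolution product, extended bilinearly. -/
noncomputable def starW (x y : FW R) : FW R :=
  x.sum fun u a => y.sum fun v b => (a * b) • convW u v

/-- Whether the word `w` is an admissible labelling of (the completion of) `t`: at each internal
node, the smallest label lies in the left subtree and the largest in the right subtree. -/
def admB : BT → List ℕ → Bool
  | .nil, _ => true
  | .nd l r, w =>
    admB l (w.take (l.nodes + 1)) && admB r (w.drop (l.nodes + 1))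
      && decide ((w.take (l.nodes + 1)).minimum = w.minimum)
      && decide ((w.drop (l.nodes + 1)).maximum = w.maximum)

/-- c_t: the sum of the evaluations T(σ) over all admissible labellings σ of the complete
binary tree whose internal nodes form `t`. -/
noncomputable def cElt (t : BT) : FW R :=
  ∑ w ∈ (permWords (t.nodes + 1)).filter (fun w => admB t w = true), evalBT t w


open MvPolynomial

/-- Narayana number T(n,k) = (1/k)·C(n−1,k−1)·C(n,k−1). -/
def narayana (n k : ℕ) : ℕ := ((n - 1).choose (k - 1) * n.choose (k - 1)) / k

/-- ca_n(a,b) = Σ_{i=0}^{n−1} T(n,i+1)·a^i·b^{n−1−i} ∈ ℤ[a,b], with a = X 0, b = X 1. -/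
noncomputable def caP (n : ℕ) : MvPolynomial (Fin 2) ℤ :=
  ∑ i ∈ Finset.range n, (narayana n (i + 1) : MvPolynomial (Fin 2) ℤ) * X 0 ^ i * X 1 ^ (n - 1 - i)

/-- Run-length encoding of a sign sequence (true = +, false = −): the minimal stack
decomposition ε = (η_1)^{n_1}⋯(η_s)^{n_s}, as the list [(η_1,n_1),…,(η_s,n_s)]. -/
def runsRLE : List Bool → List (Bool × ℕ)
  | [] => []
  | x :: xs =>
    match runsRLE xs with
    | [] => [(x, 1)]
    | (y, k) :: rest => if x = y then (y, k + 1) :: rest else (x, 1) :: (y, k) :: rest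

/-- The weight w(ε) = (Π_{1≤i<s, η_i=+} a)·(Π_{1≤i<s, η_i=−} b)·ca_{n_1}(a,b)⋯ca_{n_s}(a,b). -/
noncomputable def wEps (ε : List Bool) : MvPolynomial (Fin 2) ℤ :=
  ((runsRLE ε).dropLast.map fun p => if p.1 then X 0 else (X 1 : MvPolynomial (Fin 2) ℤ)).prod
    * ((runsRLE ε).map fun p => caP p.2).prod

/-- E(ε) = {1 ≤ i ≤ n−1 : ε_i = −} (1-based positions, false = −). -/
def esetOf (ε : List Bool) : Finset ℕ :=
  (Finset.Icc 1 ε.length).filter fun i => ε.getD (i - 1) true = false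

/-- The descent set Des(w) = {i ∈ {1,…,|w|−1} : w(i) > w(i+1)} of a word (1-based). -/
def desSet (w : List ℕ) : Finset ℕ :=
  (Finset.Icc 1 (w.length - 1)).filter fun i => w.getD i 0 < w.getD (i - 1) 0

/-- The Catalan element D^n_{a,b} ∈ ℤ[a,b][S_n]. -/
noncomputable def DCat (n : ℕ) : FW (MvPolynomial (Fin 2) ℤ) :=
  ∑ f : Fin (n - 1) → Bool,
    (wEps (List.ofFn f) * (-1) ^ (esetOf (List.ofFn f)).card) •
      ∑ σ ∈ (permWords n).filter (fun σ => desSet σ = esetOf (List.ofFn f)),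
        Finsupp.single σ (1 : MvPolynomial (Fin 2) ℤ)

/-- The finite set of all binary trees with m nodes. -/
def allBT : ℕ → Finset BT
  | 0 => {BT.nil}
  | m + 1 =>
    (Finset.range (m + 1)).attach.biUnion fun k =>
      ((allBT k.1) ×ˢ (allBT (m - k.1))).image fun p => BT.nd p.1 p.2
decreasing_by
  · exact k.2 |> Finset.mem_range.mp
  · omega

/-- The number of left edges of a binary tree. -/
def leftE : BT → ℕ
  | .nil => 0
  | .nd l r => leftE l + leftE r + (if l = BT.nil then 0 else 1)

/-- The number of right edges of a binary tree. -/
def rightE : BT → ℕ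
  | .nil => 0
  | .nd l r => rightE l + rightE r + (if r = BT.nil then 0 else 1)


/-- The `k`-th convolution powers of the Narayana polynomials, by their linear recursion. -/
noncomputable def narPow : ℕ → ℕ → MvPolynomial (Fin 2) ℤ
  | 0, 0 => 1
  | 0, _ + 1 => 0
  | _ + 1, 0 => 0
  | n + 1, k + 1 =>
    narPow n k + (X 0 + X 1) * narPow n (k + 1) + X 0 * X 1 * narPow n (k + 2)

theorem narPow_conv (n : ℕ) : ∀ k : ℕ,
    ∑ p ∈ Finset.HasAntidiagonal.antidiagonal n, narPow p.1 1 * narPow p.2 k = narPow n (k + 1) := by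
  induction n with
  | zero => intro k; cases k <;> simp [narPow]
  | succ n ih =>
    intro k
    rw [Finset.Nat.sum_antidiagonal_succ']
    cases k with
    | zero => simp [narPow]
    | succ k =>
      simp only [narPow, mul_zero, zero_add]
      rw [← ih k, ← ih (k + 1), ← ih (k + 2), Finset.mul_sum, Finset.mul_sum,
        ← Finset.sum_add_distrib, ← Finset.sum_add_distrib]
      refine Finset.sum_congr rfl fun p _ => ?_
      ring

/-- The polynomial `((1 + a u)(1 + b u))^n` in `u`. -/
noncomputable def narPhi (n : ℕ) : Polynomial (MvPolynomial (Fin 2) ℤ) :=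
  (1 + Polynomial.C (X 0) * Polynomial.X) ^ n * (1 + Polynomial.C (X 1) * Polynomial.X) ^ n

theorem coeff_one_add_C_mul_X_pow {S : Type*} [CommRing S] (c : S) (n i : ℕ) :
    ((1 + Polynomial.C c * Polynomial.X) ^ n).coeff i = (n.choose i : S) * c ^ i := by
  have h : ((1 + Polynomial.C c * Polynomial.X) ^ n : Polynomial S)
      = ((1 + Polynomial.X) ^ n).comp (Polynomial.C c * Polynomial.X) := by simp
  rw [h, Polynomial.comp_C_mul_X_coeff, Polynomial.coeff_one_add_X_pow]

theorem narPhi_coeff (n d : ℕ) : (narPhi n).coeff d =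
    ∑ p ∈ Finset.HasAntidiagonal.antidiagonal d,
      ((n.choose p.1 * n.choose p.2 : ℕ) : MvPolynomial (Fin 2) ℤ) * (X 0 ^ p.1 * X 1 ^ p.2) := by
  rw [narPhi, Polynomial.coeff_mul]
  refine Finset.sum_congr rfl fun p _ => ?_
  rw [coeff_one_add_C_mul_X_pow, coeff_one_add_C_mul_X_pow]
  push_cast
  ring

theorem narPhi_succ (n : ℕ) : narPhi (n + 1) = narPhi n
    + Polynomial.C (X 0 + X 1) * (narPhi n * Polynomial.X)
    + Polynomial.C (X 0 * X 1) * (narPhi n * Polynomial.X ^ 2) := by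
  simp only [narPhi, Polynomial.C_add, Polynomial.C_mul]
  ring

/-- The polynomial whose coefficients are the values of `narPow`. -/
noncomputable def narQ (n : ℕ) : Polynomial (MvPolynomial (Fin 2) ℤ) :=
  narPhi n - Polynomial.C (X 0 * X 1) * (narPhi n * Polynomial.X ^ 2)

theorem narQ_succ (n : ℕ) : narQ (n + 1) = narQ n
    + Polynomial.C (X 0 + X 1) * (narQ n * Polynomial.X)
    + Polynomial.C (X 0 * X 1) * (narQ n * Polynomial.X ^ 2) := by
  simp only [narQ, narPhi_succ]
  ring

theorem narQ_coeff_succ_self (n : ℕ) : (narQ n).coeff (n + 1) = 0 := by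
  cases n with
  | zero =>
    rw [narQ, Polynomial.coeff_sub, Polynomial.coeff_C_mul, Polynomial.coeff_mul_X_pow']
    simp [narPhi, Polynomial.coeff_one]
  | succ m =>
    rw [narQ, Polynomial.coeff_sub, Polynomial.coeff_C_mul, Polynomial.coeff_mul_X_pow,
      narPhi_coeff, narPhi_coeff, Finset.Nat.antidiagonal_succ_succ']
    simp only [Finset.sum_cons, Finset.sum_map, Finset.mul_sum]
    rw [Nat.choose_succ_self]
    simp only [mul_zero, zero_mul, Nat.cast_zero, zero_add, sub_eq_zero]
    refine Finset.sum_congr rfl fun p hp => ?_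
    have hp := Finset.HasAntidiagonal.mem_antidiagonal.mp hp
    have h1 : (m + 1).choose (p.1 + 1) = (m + 1).choose p.2 :=
      Nat.choose_symm_of_eq_add (by omega)
    have h2 : (m + 1).choose (p.2 + 1) = (m + 1).choose p.1 :=
      Nat.choose_symm_of_eq_add (by omega)
    simp only [Function.Embedding.prodMap, Function.Embedding.coeFn_mk, Prod.map_fst,
      Prod.map_snd, Nat.succ_eq_add_one, h1, h2]
    push_cast
    ring

theorem narPow_eq_zero (n : ℕ) : ∀ k, n < k → narPow n k = 0 := by
  induction n with
  | zero => intro k hk; cases k <;> simp_all [narPow]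
  | succ n ih =>
    intro k hk
    cases k with
    | zero => simp [narPow]
    | succ k => simp [narPow, ih k (by omega), ih (k + 1) (by omega), ih (k + 2) (by omega)]

theorem narPow_eq_coeff (n : ℕ) : ∀ k d, k + d = n + 1 →
    narPow (n + 1) k = (narQ n).coeff d := by
  induction n with
  | zero =>
    intro k d h
    obtain ⟨rfl, rfl⟩ | ⟨rfl, rfl⟩ : k = 0 ∧ d = 1 ∨ k = 1 ∧ d = 0 := by omega
    · rw [narQ_coeff_succ_self]; simp [narPow]
    · simp [narPow, narQ, narPhi]
  | succ n ih =>
    intro k d h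
    cases k with
    | zero =>
      obtain rfl : d = n + 1 + 1 := by omega
      rw [narQ_coeff_succ_self]; simp [narPow]
    | succ k =>
      rw [narPow, narQ_succ, Polynomial.coeff_add, Polynomial.coeff_add, Polynomial.coeff_C_mul,
        Polynomial.coeff_C_mul, ih k d (by omega)]
      match d, h with
      | 0, h =>
        rw [narPow_eq_zero _ _ (by omega), narPow_eq_zero _ _ (by omega)]
        simp
      | 1, h =>
        rw [narPow_eq_zero _ (k + 2) (by omega), ih (k + 1) 0 (by omega),
          Polynomial.coeff_mul_X]
        rw [Polynomial.coeff_mul_X_pow']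
        simp
      | d + 2, h =>
        rw [ih (k + 2) d (by omega), ih (k + 1) (d + 1) (by omega),
          Polynomial.coeff_mul_X, Polynomial.coeff_mul_X_pow]

theorem narayana_one_right (n : ℕ) : narayana (n + 1) 1 = 1 := by simp [narayana]

theorem narayana_succ (n i : ℕ) : (narayana (n + 1) (i + 2) : ℤ)
    = n.choose (i + 1) * n.choose (i + 1) - n.choose i * n.choose (i + 2) := by
  have h2 : ((i : ℤ) + 2) * n.choose (i + 2) = (n - (i + 1)) * n.choose (i + 1) := by
    rcases le_or_gt (i + 1) n with h | h
    · have := Nat.choose_succ_right_eq n (i + 1)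
      zify [h] at this
      linarith
    · rw [Nat.choose_eq_zero_of_lt h, Nat.choose_eq_zero_of_lt (by omega : n < i + 2)]; simp
  have h3 : ((i : ℤ) + 1) * n.choose (i + 1) = (n - i) * n.choose i := by
    rcases le_or_gt i n with h | h
    · have := Nat.choose_succ_right_eq n i
      zify [h] at this
      linarith
    · rw [Nat.choose_eq_zero_of_lt h, Nat.choose_eq_zero_of_lt (by omega : n < i + 1)]; simp
  rw [narayana]
  push_cast
  apply Int.ediv_eq_of_eq_mul_left (by positivity)
  simp only [Nat.choose_succ_succ' n i]
  push_cast
  linear_combination (n.choose i : ℤ) * h2 - (n.choose (i + 1) : ℤ) * h3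

theorem narayana_self (n : ℕ) : narayana (n + 1) (n + 1) = 1 := by
  simp [narayana]

theorem caP_succ (n : ℕ) : caP (n + 1) = narPow (n + 1) 1 := by
  rw [narPow_eq_coeff n 1 n (by omega), caP, narQ, Polynomial.coeff_sub, Polynomial.coeff_C_mul,
    Polynomial.coeff_mul_X_pow', narPhi_coeff, narPhi_coeff]
  have h : ∑ i ∈ Finset.range (n + 1),
      (narayana (n + 1) (i + 1) : MvPolynomial (Fin 2) ℤ) * X 0 ^ i * X 1 ^ (n + 1 - 1 - i)
      = ∑ p ∈ Finset.HasAntidiagonal.antidiagonal n,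
        (narayana (n + 1) (p.1 + 1) : MvPolynomial (Fin 2) ℤ) * X 0 ^ p.1 * X 1 ^ p.2 := by
    rw [Finset.Nat.sum_antidiagonal_eq_sum_range_succ_mk]
    simp
  rw [h]
  match n with
  | 0 => simp [narayana]
  | 1 => simp [Finset.Nat.antidiagonal_succ, narayana]
  | n + 2 =>
    rw [Finset.Nat.antidiagonal_succ_succ']
    simp only [Finset.sum_cons, Finset.sum_map]
    rw [if_pos (by omega), Nat.add_sub_cancel, narayana_one_right, narayana_self]
    have key : ∀ p ∈ Finset.HasAntidiagonal.antidiagonal n,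
        (narayana (n + 2 + 1) (p.1 + 1 + 1) : MvPolynomial (Fin 2) ℤ) =
        (((n + 2).choose (p.1 + 1) * (n + 2).choose (p.2 + 1) : ℕ) : MvPolynomial (Fin 2) ℤ)
        - (((n + 2).choose p.1 * (n + 2).choose p.2 : ℕ) : MvPolynomial (Fin 2) ℤ) := by
      intro p hp
      have hp := Finset.HasAntidiagonal.mem_antidiagonal.mp hp
      have h1 : (n + 2).choose (p.2 + 1) = (n + 2).choose (p.1 + 1) :=
        Nat.choose_symm_of_eq_add (by omega)
      have h2 : (n + 2).choose p.2 = (n + 2).choose (p.1 + 2) :=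
        Nat.choose_symm_of_eq_add (by omega)
      rw [h1, h2]
      exact_mod_cast congrArg (Int.cast : ℤ → MvPolynomial (Fin 2) ℤ) (narayana_succ (n + 2) p.1)
    simp only [Function.Embedding.prodMap, Function.Embedding.coeFn_mk, Prod.map_fst, Prod.map_snd,
      Nat.succ_eq_add_one]
    have shift : ∀ p ∈ Finset.HasAntidiagonal.antidiagonal n,
        (narayana (n + 2 + 1) (p.1 + 1 + 1) : MvPolynomial (Fin 2) ℤ)
          * X 0 ^ (p.1 + 1) * X 1 ^ (p.2 + 1)
        = (((n + 2).choose (p.1 + 1) * (n + 2).choose (p.2 + 1) : ℕ) : MvPolynomial (Fin 2) ℤ)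
          * (X 0 ^ (p.1 + 1) * X 1 ^ (p.2 + 1))
        - X 0 * X 1 * ((((n + 2).choose p.1 * (n + 2).choose p.2 : ℕ) : MvPolynomial (Fin 2) ℤ)
          * (X 0 ^ p.1 * X 1 ^ p.2)) := by
      intro p hp
      rw [key p hp]
      ring
    rw [Finset.sum_congr rfl shift, Finset.sum_sub_distrib, ← Finset.mul_sum]
    simp
    ring

theorem narPow_one (n : ℕ) : narPow n 1 = caP n := by
  cases n with
  | zero => simp [narPow, caP]
  | succ n => exact (caP_succ n).symm

/-- `1` for `n = 0`, and `x · ca_n(a,b)` for `n ≥ 1`. -/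
noncomputable def scaledCa (x : MvPolynomial (Fin 2) ℤ) (n : ℕ) : MvPolynomial (Fin 2) ℤ :=
  if n = 0 then 1 else x * caP n

theorem scaledCa_eq (x : MvPolynomial (Fin 2) ℤ) (n : ℕ) :
    scaledCa x n = narPow n 0 + x * narPow n 1 := by
  rw [narPow_one]
  cases n <;> simp [scaledCa, narPow, caP]

theorem caP_conv {y z : MvPolynomial (Fin 2) ℤ} (hs : y + z = X 0 + X 1) (hp : y * z = X 0 * X 1)
    (n : ℕ) : ∑ i ∈ Finset.range (n + 1), scaledCa y i * scaledCa z (n - i) = caP (n + 1) := by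
  have h0 : ∀ k, ∑ p ∈ Finset.HasAntidiagonal.antidiagonal n, narPow p.1 0 * narPow p.2 k = narPow n k := by
    intro k
    cases n with
    | zero => simp [narPow]
    | succ n => rw [Finset.Nat.sum_antidiagonal_succ]; simp [narPow]
  rw [← Finset.Nat.sum_antidiagonal_eq_sum_range_succ_mk
    (f := fun p => scaledCa y p.1 * scaledCa z p.2), caP_succ]
  have expand : ∀ p ∈ Finset.HasAntidiagonal.antidiagonal n, scaledCa y p.1 * scaledCa z p.2
      = narPow p.1 0 * narPow p.2 0 + z * (narPow p.1 0 * narPow p.2 1)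
        + y * (narPow p.1 1 * narPow p.2 0) + y * z * (narPow p.1 1 * narPow p.2 1) := by
    intro p _
    rw [scaledCa_eq, scaledCa_eq]
    ring
  rw [Finset.sum_congr rfl expand]
  simp only [Finset.sum_add_distrib, ← Finset.mul_sum, h0, narPow_conv, narPow, ← hs, ← hp]
  ring

theorem runsRLE_cons (x : Bool) (l : List Bool) : ∃ k r, runsRLE (x :: l) = (x, k) :: r := by
  rw [runsRLE]
  split
  · exact ⟨_, _, rfl⟩
  · split
    · next h => exact ⟨_, _, by rw [h]⟩
    · exact ⟨_, _, rfl⟩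

theorem runsRLE_eq_nil {l : List Bool} : runsRLE l = [] ↔ l = [] := by
  cases l with
  | nil => simp [runsRLE]
  | cons x l => obtain ⟨k, r, h⟩ := runsRLE_cons x l; simp [h]

theorem runsRLE_append {l r : List Bool} (h : ∀ x ∈ l.getLast?, ∀ y ∈ r.head?, x ≠ y) :
    runsRLE (l ++ r) = runsRLE l ++ runsRLE r := by
  induction l with
  | nil => simp [runsRLE]
  | cons x l ih =>
    cases l with
    | nil =>
      cases r with
      | nil => simp [runsRLE]
      | cons y r =>
        obtain ⟨k, s, hs⟩ := runsRLE_cons y r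
        have hxy : x ≠ y := by simpa using h
        simp only [List.cons_append, List.nil_append]
        rw [runsRLE, hs]
        simp [runsRLE, hxy]
    | cons z l =>
      have ih := ih (by simpa using h)
      obtain ⟨k, s, hs⟩ := runsRLE_cons z l
      simp only [List.cons_append] at ih ⊢
      rw [runsRLE, ih, hs, runsRLE, hs]
      by_cases hxz : x = z <;> simp [hxz]

theorem runsRLE_getLast? (l : List Bool) :
    (runsRLE l).getLast?.map Prod.fst = l.getLast? := by
  induction l with
  | nil => simp [runsRLE]
  | cons x l ih =>
    cases l with
    | nil => simp [runsRLE]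
    | cons z l =>
      obtain ⟨k, s, hs⟩ := runsRLE_cons z l
      rw [runsRLE, hs]
      rw [hs] at ih
      rw [List.getLast?_cons_cons, ← ih]
      by_cases hxz : x = z
      · cases s <;> simp [hxz]
      · simp [hxz]

theorem runsRLE_replicate (k : ℕ) (c : Bool) :
    runsRLE (List.replicate (k + 1) c) = [(c, k + 1)] := by
  induction k with
  | zero => simp [runsRLE]
  | succ k ih => rw [List.replicate_succ, runsRLE, ih]; simp

/-- The variable attached to a sign: `a` for `+` and `b` for `−`. -/
noncomputable def signVar (c : Bool) : MvPolynomial (Fin 2) ℤ := if c then X 0 else X 1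

/-- The unit attached to a sign. -/
noncomputable def signUnit (c : Bool) : MvPolynomial (Fin 2) ℤ := if c then 1 else -1

theorem signUnit_not (c : Bool) : signUnit (!c) = -signUnit c := by cases c <;> simp [signUnit]

theorem wEps_append {l r : List Bool} {x : Bool} (hl : l.getLast? = some x)
    (hr : r.head? = some (!x)) : wEps (l ++ r) = wEps l * signVar x * wEps r := by
  have happ : runsRLE (l ++ r) = runsRLE l ++ runsRLE r := by
    apply runsRLE_append
    simp [hl, hr]
  have hr' : runsRLE r ≠ [] := by
    rw [Ne, runsRLE_eq_nil]; rintro rfl; simp at hr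
  have hlast := runsRLE_getLast? l
  rw [hl, Option.map_eq_some_iff] at hlast
  obtain ⟨p, hp, hpx⟩ := hlast
  obtain ⟨s, hs⟩ := List.getLast?_eq_some_iff.mp hp
  rw [wEps, happ, wEps, wEps, List.dropLast_append_of_ne_nil hr', hs]
  simp only [List.map_append, List.prod_append, List.dropLast_concat, List.map_cons, List.map_nil,
    List.prod_cons, List.prod_nil, mul_one, hpx, signVar]
  ring

/-- The coefficient of a permutation with sign sequence `ε` in the Catalan element. -/
noncomputable def signedW (ε : List Bool) : MvPolynomial (Fin 2) ℤ :=
  (-1) ^ ε.count false * wEps ε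

theorem signedW_append {l r : List Bool} {x : Bool} (hl : l.getLast? = some x)
    (hr : r.head? = some (!x)) : signedW (l ++ r) = signedW l * signVar x * signedW r := by
  rw [signedW, wEps_append hl hr, signedW, signedW, List.count_append]
  ring

theorem signedW_nil : signedW [] = 1 := by simp [signedW, wEps, runsRLE]

theorem signedW_replicate (k : ℕ) (c : Bool) :
    signedW (List.replicate (k + 1) c) = signUnit c ^ (k + 1) * caP (k + 1) := by
  rw [signedW, wEps, runsRLE_replicate]
  cases c <;> simp [signUnit, List.count_replicate]

/-- `1` for the empty sequence, and `x` times the signed weight otherwise. -/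
noncomputable def extW (x : MvPolynomial (Fin 2) ℤ) (ε : List Bool) : MvPolynomial (Fin 2) ℤ :=
  if ε = [] then 1 else x * signedW ε

theorem extW_append_replicate {l : List Bool} {c : Bool} (hl : ∀ x ∈ l.getLast?, x = !c) (i : ℕ) :
    extW (signVar !c) (l ++ List.replicate i c)
      = extW (signVar !c) l * (signUnit c ^ i * scaledCa (signVar !c) i) := by
  cases i with
  | zero => simp [scaledCa]
  | succ i =>
    rcases hx : l.getLast? with _ | x
    · rw [List.getLast?_eq_none_iff] at hx
      subst hx
      simp only [extW, scaledCa, List.nil_append, signedW_replicate]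
      simp
      ring
    · have hne : l ≠ [] := by rintro rfl; simp at hx
      obtain rfl : x = !c := hl x (by simp [hx])
      simp only [extW, scaledCa]
      rw [signedW_append hx (by simp [List.head?_replicate]), signedW_replicate]
      simp [hne]
      ring

theorem extW_replicate_append {r : List Bool} {c : Bool} (hr : ∀ x ∈ r.head?, x = !c) (i : ℕ) :
    extW (signVar c) (List.replicate i c ++ r)
      = signUnit c ^ i * scaledCa (signVar c) i * extW (signVar c) r := by
  cases i with
  | zero => simp [scaledCa]
  | succ i =>
    rcases hx : r.head? with _ | x
    · rw [List.head?_eq_none_iff] at hx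
      subst hx
      simp only [extW, scaledCa, List.append_nil, signedW_replicate]
      simp
      ring
    · have hne : r ≠ [] := by rintro rfl; simp at hx
      obtain rfl : x = !c := hr x (by simp [hx])
      simp only [extW, scaledCa]
      rw [signedW_append (x := c) (by simp [List.getLast?_replicate]) hx, signedW_replicate]
      simp [hne]
      ring

theorem signedW_run {l r : List Bool} {c : Bool} (hl : ∀ x ∈ l.getLast?, x = !c)
    (hr : ∀ x ∈ r.head?, x = !c) (k : ℕ) :
    signedW (l ++ (List.replicate (k + 1) c ++ r))
      = extW (signVar !c) l * (signUnit c ^ (k + 1) * caP (k + 1)) * extW (signVar c) r := by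
  have h1 : signedW (List.replicate (k + 1) c ++ r)
      = signUnit c ^ (k + 1) * caP (k + 1) * extW (signVar c) r := by
    rcases hx : r.head? with _ | x
    · rw [List.head?_eq_none_iff] at hx
      simp [hx, extW, signedW_replicate]
    · have hne : r ≠ [] := by rintro rfl; simp at hx
      obtain rfl : x = !c := hr x (by simp [hx])
      rw [signedW_append (x := c) (by simp [List.getLast?_replicate]) hx, signedW_replicate]
      simp [hne, extW]
      ring
  rcases hx : l.getLast? with _ | x
  · rw [List.getLast?_eq_none_iff] at hx
    simp [hx, extW, h1]
  · have hne : l ≠ [] := by rintro rfl; simp at hx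
    obtain rfl : x = !c := hl x (by simp [hx])
    rw [signedW_append hx (by simp [List.replicate_succ]), h1,
      show extW (signVar !c) l = signVar (!c) * signedW l from if_neg hne]
    ring

/-- The contribution of cutting the sign sequence `ε` at its entry `i`. -/
noncomputable def cutTerm (c : Bool) (ε : List Bool) (i : ℕ) : MvPolynomial (Fin 2) ℤ :=
  extW (signVar !c) (ε.take i) * extW (signVar c) (ε.drop (i + 1))

theorem cutTerm_not {c : Bool} {ε : List Bool} {i : ℕ} (h0 : 0 < i) (h1 : i + 1 < ε.length) :
    cutTerm (!c) ε i = cutTerm c ε i := by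
  have ht : ε.take i ≠ [] := by
    rw [← List.length_pos_iff, List.length_take]; omega
  have hd : ε.drop (i + 1) ≠ [] := by
    rw [← List.length_pos_iff, List.length_drop]; omega
  simp only [cutTerm, extW, ht, hd, if_false, Bool.not_not]
  ring

theorem sum_cutTerm_run {l r : List Bool} {c : Bool} (hl : ∀ x ∈ l.getLast?, x = !c)
    (hr : ∀ x ∈ r.head?, x = !c) (k : ℕ) :
    ∑ i ∈ Finset.Ico l.length (l.length + (k + 1)),
      cutTerm c (l ++ (List.replicate (k + 1) c ++ r)) i
      = signUnit c * signedW (l ++ (List.replicate (k + 1) c ++ r)) := by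
  have hterm : ∀ i ∈ Finset.range (k + 1),
      cutTerm c (l ++ (List.replicate (k + 1) c ++ r)) (l.length + i)
      = extW (signVar !c) l * signUnit c ^ k * extW (signVar c) r
        * (scaledCa (signVar !c) i * scaledCa (signVar c) (k - i)) := by
    intro i hi
    have hi := Finset.mem_range.mp hi
    obtain ⟨j, rfl⟩ : ∃ j, k = i + j := ⟨k - i, by omega⟩
    have ht : (l ++ (List.replicate (i + j + 1) c ++ r)).take (l.length + i)
        = l ++ List.replicate i c := by
      rw [List.take_length_add_append, List.take_append_of_le_length (by simp; omega),
        List.take_replicate]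
      congr 2; omega
    have hd : (l ++ (List.replicate (i + j + 1) c ++ r)).drop (l.length + i + 1)
        = List.replicate j c ++ r := by
      rw [add_assoc, List.drop_length_add_append, List.drop_append_of_le_length (by simp),
        List.drop_replicate]
      congr 2; omega
    rw [cutTerm, ht, hd, extW_append_replicate hl, extW_replicate_append hr,
      Nat.add_sub_cancel_left, pow_add]
    ring
  rw [Finset.sum_Ico_eq_sum_range, Nat.add_sub_cancel_left, Finset.sum_congr rfl hterm,
    ← Finset.mul_sum, caP_conv (by cases c <;> simp [signVar, add_comm])
      (by cases c <;> simp [signVar, mul_comm]), signedW_run hl hr]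
  have : signUnit c * signUnit c = 1 := by cases c <;> simp [signUnit]
  linear_combination (-(extW (signVar !c) l * signUnit c ^ k * extW (signVar c) r
    * caP (k + 1))) * this

theorem exists_eq_replicate_append {γ : List Bool} {c : Bool} (h : γ.head? = some c) :
    ∃ k r, γ = List.replicate (k + 1) c ++ r ∧ ∀ x ∈ r.head?, x = !c := by
  induction γ with
  | nil => simp at h
  | cons y γ ih =>
    obtain rfl : y = c := by simpa using h
    rcases hx : γ.head? with _ | x
    · exact ⟨0, γ, by simp, by simp [hx]⟩
    · by_cases hxy : x = y
      · obtain ⟨k, r, h1, h2⟩ := ih (by rw [hx, hxy])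
        exact ⟨k + 1, r, by rw [h1, List.replicate_succ (n := k + 1)]; simp, h2⟩
      · exact ⟨0, γ, by simp, by simpa [hx] using Bool.eq_not.mpr hxy⟩

theorem sum_cutTerm {c : Bool} (N : ℕ) : ∀ {l γ r : List Bool}, γ.length ≤ N →
    γ.head? = some c → γ.getLast? = some c → (∀ x ∈ l.getLast?, x = !c) →
    (∀ x ∈ r.head?, x = !c) →
    ∑ i ∈ Finset.Ico l.length (l.length + γ.length), cutTerm c (l ++ (γ ++ r)) i
      = signUnit c * signedW (l ++ (γ ++ r)) := by
  induction N with
  | zero =>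
    intro l γ r hN hh
    simp [List.length_eq_zero_iff.mp (Nat.le_zero.mp hN)] at hh
  | succ N ih =>
    intro l γ r hN hh hlast hl hr
    obtain ⟨k, s, rfl, hs⟩ := exists_eq_replicate_append hh
    rcases hx : s.head? with _ | x
    · rw [List.head?_eq_none_iff] at hx
      subst hx
      simpa using sum_cutTerm_run hl hr k
    obtain rfl : x = !c := hs x (by simp [hx])
    obtain ⟨m, t, rfl, ht⟩ := exists_eq_replicate_append hx
    rcases hy : t.head? with _ | y
    · rw [List.head?_eq_none_iff] at hy
      subst hy
      simp [List.getLast?_append, List.getLast?_replicate] at hlast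
    obtain rfl : y = c := by simpa using ht y (by simp [hy])
    have hne : t ≠ [] := by rintro rfl; simp at hy
    have hpos := List.length_pos_iff.mpr hne
    have hlast' : t.getLast? = some y := by
      rw [← hlast, ← List.append_assoc, List.getLast?_append_of_ne_nil _ hne]
    have e1 : l ++ (List.replicate (k + 1) y ++ (List.replicate (m + 1) (!y) ++ t) ++ r)
        = l ++ (List.replicate (k + 1) y ++ (List.replicate (m + 1) (!y) ++ (t ++ r))) := by simp
    have e2 : l ++ (List.replicate (k + 1) y ++ (List.replicate (m + 1) (!y) ++ (t ++ r)))
        = (l ++ List.replicate (k + 1) y) ++ (List.replicate (m + 1) (!y) ++ (t ++ r)) := by simp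
    have e3 : l ++ (List.replicate (k + 1) y ++ (List.replicate (m + 1) (!y) ++ (t ++ r)))
        = (l ++ List.replicate (k + 1) y ++ List.replicate (m + 1) (!y)) ++ (t ++ r) := by simp
    have s1 := sum_cutTerm_run (r := List.replicate (m + 1) (!y) ++ (t ++ r)) hl
      (by simp [List.replicate_succ]) k
    have s2 := sum_cutTerm_run (l := l ++ List.replicate (k + 1) y) (c := !y) (r := t ++ r)
      (by simp [List.getLast?_append, List.getLast?_replicate])
      (by simp [List.head?_append, hy]) m
    have s3 := ih (l := l ++ List.replicate (k + 1) y ++ List.replicate (m + 1) (!y)) (γ := t)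
      (r := r) (by simp at hN; omega) hy hlast'
      (by simp [List.getLast?_append, List.getLast?_replicate]) hr
    rw [← e2] at s2
    rw [← e3] at s3
    rw [e1]
    generalize hε : l ++ (List.replicate (k + 1) y ++ (List.replicate (m + 1) (!y) ++ (t ++ r))) = ε
      at s1 s2 s3 ⊢
    have hlen : ε.length = l.length + (k + 1) + (m + 1) + t.length + r.length := by
      rw [← hε]; simp; omega
    simp only [List.length_append, List.length_replicate] at s2 s3 ⊢
    have s2' : ∑ i ∈ Finset.Ico (l.length + (k + 1)) (l.length + (k + 1) + (m + 1)),
        cutTerm y ε i = signUnit (!y) * signedW ε := by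
      rw [← s2]
      refine Finset.sum_congr rfl fun i hi => ?_
      have hi := Finset.mem_Ico.mp hi
      exact (cutTerm_not (by omega) (by omega)).symm
    rw [← Finset.sum_Ico_consecutive _ (by omega : l.length ≤ l.length + (k + 1)) (by omega),
      ← Finset.sum_Ico_consecutive _
        (by omega : l.length + (k + 1) ≤ l.length + (k + 1) + (m + 1)) (by omega), s1, s2',
      show l.length + (k + 1 + (m + 1 + t.length)) = l.length + (k + 1) + (m + 1) + t.length by
        omega, s3, signUnit_not]
    ring

/-- Summing the cuts between a beginning `p` of a run of sign `c` and an end `q` of such a run. -/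
theorem sum_cutTerm_Ico {c : Bool} {ε : List Bool} {p q : ℕ} (hpq : p < q) (hq : q ≤ ε.length)
    (hp1 : ε[p]? = some c) (hp0 : p ≠ 0 → ε[p - 1]? = some (!c))
    (hq1 : ε[q - 1]? = some c) (hq0 : q ≠ ε.length → ε[q]? = some (!c)) :
    ∑ i ∈ Finset.Ico p q, cutTerm c ε i = signUnit c * signedW ε := by
  have e : ε = ε.take p ++ ((ε.drop p).take (q - p) ++ ε.drop q) := by
    conv_lhs => rw [← List.take_append_drop p ε, ← List.take_append_drop (q - p) (ε.drop p)]
    rw [List.drop_drop, Nat.add_sub_cancel' hpq.le]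
  have h := sum_cutTerm (c := c) (q - p) (l := ε.take p) (γ := (ε.drop p).take (q - p))
    (r := ε.drop q) (by simp)
    (by rw [List.head?_take, if_neg (by omega), List.head?_drop, hp1])
    (by
      rw [List.getLast?_take, if_neg (by omega), List.getElem?_drop,
        show p + (q - p - 1) = q - 1 by omega, hq1]; simp)
    (by
      rw [List.getLast?_take]
      split
      · simp
      · next h => rw [hp0 h]; simp)
    (by
      rw [List.head?_drop]
      by_cases h : q = ε.length
      · simp [h]
      · rw [hq0 h]; simp)
  rw [← e] at h
  simpa [min_eq_left (hpq.le.trans hq), min_eq_left (Nat.sub_le_sub_right hq p),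
    Nat.add_sub_cancel' hpq.le] using h

theorem catW_apply {x y : FW R} {k : ℕ} (hx : ∀ u, x u ≠ 0 → u.length = k) (σ : List ℕ) :
    catW x y σ = x (σ.take k) * y (σ.drop k) := by
  have inner : ∀ u ∈ x.support,
      (y.sum fun v b => Finsupp.single (u ++ v) (x u * b)) σ
        = if u = σ.take k then x u * y (σ.drop k) else 0 := by
    intro u hu
    have hk := hx u (Finsupp.mem_support_iff.mp hu)
    rw [Finsupp.sum_apply, Finsupp.sum]
    split
    · next h =>
      rw [Finset.sum_eq_single (σ.drop k)]
      · rw [h, List.take_append_drop, Finsupp.single_eq_same]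
      · intro v _ hv
        rw [Finsupp.single_eq_of_ne]
        rintro rfl
        exact hv (by rw [← hk, List.drop_left])
      · intro h0
        rw [Finsupp.notMem_support_iff.mp h0]
        simp
    · next h =>
      refine Finset.sum_eq_zero fun v _ => ?_
      rw [Finsupp.single_eq_of_ne]
      rintro rfl
      exact h (by rw [← hk, List.take_left])
  rw [catW, Finsupp.sum_apply, Finsupp.sum, Finset.sum_congr rfl inner, Finset.sum_ite_eq']
  split
  · rfl
  · next h => rw [Finsupp.notMem_support_iff.mp h, zero_mul]

theorem evalBT_perm {t : BT} : ∀ {w σ : List ℕ}, w.length = t.nodes + 1 →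
    (evalBT t w : FW R) σ ≠ 0 → σ.Perm w := by
  induction t with
  | nil =>
    intro w σ _ h
    rw [evalBT, Finsupp.single_apply] at h
    by_cases hw : w = σ
    · rw [hw]
    · simp [hw] at h
  | nd l r ihl ihr =>
    intro w σ hw h
    rw [BT.nodes] at hw
    have hwl : (w.take (l.nodes + 1)).length = l.nodes + 1 := by rw [List.length_take]; omega
    have hwr : (w.drop (l.nodes + 1)).length = r.nodes + 1 := by rw [List.length_drop]; omega
    rw [evalBT, brakW, Finsupp.sub_apply,
      catW_apply (k := l.nodes + 1) fun u hu => (ihl hwl hu).length_eq.trans hwl,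
      catW_apply (k := r.nodes + 1) fun u hu => (ihr hwr hu).length_eq.trans hwr] at h
    by_cases h1 : (evalBT l (w.take (l.nodes + 1)) : FW R) (σ.take (l.nodes + 1))
        * (evalBT r (w.drop (l.nodes + 1)) : FW R) (σ.drop (l.nodes + 1)) = 0
    · rw [h1, zero_sub, neg_ne_zero] at h
      have a1 := ihr hwr (left_ne_zero_of_mul h)
      have a2 := ihl hwl (right_ne_zero_of_mul h)
      have := (a1.append a2).trans List.perm_append_comm
      rwa [List.take_append_drop, List.take_append_drop] at this
    · have a1 := ihl hwl (left_ne_zero_of_mul h1)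
      have a2 := ihr hwr (right_ne_zero_of_mul h1)
      have := a1.append a2
      rwa [List.take_append_drop, List.take_append_drop] at this

theorem evalBT_nd_apply {l r : BT} {w : List ℕ} (hw : w.length = l.nodes + r.nodes + 2)
    (σ : List ℕ) : (evalBT (.nd l r) w : FW R) σ
      = (evalBT l (w.take (l.nodes + 1)) : FW R) (σ.take (l.nodes + 1))
          * (evalBT r (w.drop (l.nodes + 1)) : FW R) (σ.drop (l.nodes + 1))
        - (evalBT l (w.take (l.nodes + 1)) : FW R) (σ.drop (r.nodes + 1))
          * (evalBT r (w.drop (l.nodes + 1)) : FW R) (σ.take (r.nodes + 1)) := by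
  have hwl : (w.take (l.nodes + 1)).length = l.nodes + 1 := by rw [List.length_take]; omega
  have hwr : (w.drop (l.nodes + 1)).length = r.nodes + 1 := by rw [List.length_drop]; omega
  rw [evalBT, brakW, Finsupp.sub_apply,
    catW_apply (k := l.nodes + 1) fun u hu => (evalBT_perm hwl hu).length_eq.trans hwl,
    catW_apply (k := r.nodes + 1) fun u hu => (evalBT_perm hwr hu).length_eq.trans hwr]
  ring

theorem sum_permutations_append {M : Type*} [AddCommMonoid M] {σ u v : List ℕ}
    (h : (u ++ v).Perm σ) (g : List ℕ → M)
    (hg : ∀ w, w.Perm σ → ¬((w.take u.length).Perm u ∧ (w.drop u.length).Perm v) → g w = 0) :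
    ∑ w ∈ σ.permutations.toFinset, g w
      = ∑ x ∈ u.permutations.toFinset, ∑ y ∈ v.permutations.toFinset, g (x ++ y) := by
  rw [← Finset.sum_product']
  symm
  refine Finset.sum_of_injOn (fun p => p.1 ++ p.2) ?_ ?_ ?_ ?_
  · rintro ⟨x, y⟩ hxy ⟨x', y'⟩ hxy' heq
    simp only [Finset.coe_product, Set.mem_prod, Finset.mem_coe, List.mem_toFinset,
      List.mem_permutations] at hxy hxy'
    have := List.append_inj heq (hxy.1.length_eq.trans hxy'.1.length_eq.symm)
    exact Prod.ext this.1 this.2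
  · rintro ⟨x, y⟩ hxy
    simp only [Finset.coe_product, Set.mem_prod, Finset.mem_coe, List.mem_toFinset,
      List.mem_permutations] at hxy ⊢
    exact (hxy.1.append hxy.2).trans h
  · intro w hw hnot
    simp only [List.mem_toFinset, List.mem_permutations] at hw
    refine hg w hw fun hc => hnot ⟨(w.take u.length, w.drop u.length), ?_, ?_⟩
    · simpa only [Finset.coe_product, Set.mem_prod, Finset.mem_coe, List.mem_toFinset,
        List.mem_permutations] using hc
    · exact List.take_append_drop _ _
  · intros; rfl

/-- The coefficient of `σ` in the sum of the evaluations of `t` at its admissible labellings by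
the letters of `σ`. -/
noncomputable def admCoeff (t : BT) (σ : List ℕ) : MvPolynomial (Fin 2) ℤ :=
  ∑ w ∈ σ.permutations.toFinset,
    if admB t w = true then (evalBT t w : FW (MvPolynomial (Fin 2) ℤ)) σ else 0

theorem sum_admissible_nd {l r : BT} {σ u v : List ℕ} (h : (u ++ v).Perm σ)
    (hu : u.length = l.nodes + 1) (hv : v.length = r.nodes + 1) :
    ∑ w ∈ σ.permutations.toFinset,
      (if admB (.nd l r) w = true then
        (evalBT l (w.take (l.nodes + 1)) : FW (MvPolynomial (Fin 2) ℤ)) u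
          * (evalBT r (w.drop (l.nodes + 1)) : FW (MvPolynomial (Fin 2) ℤ)) v
      else 0)
      = if u.minimum = σ.minimum ∧ v.maximum = σ.maximum then admCoeff l u * admCoeff r v
        else 0 := by
  rw [sum_permutations_append h]
  · rw [admCoeff, admCoeff, Finset.sum_mul_sum]
    simp only [← Finset.sum_product']
    have hterm : ∀ p ∈ u.permutations.toFinset ×ˢ v.permutations.toFinset,
        (if admB (.nd l r) (p.1 ++ p.2) = true then
          (evalBT l ((p.1 ++ p.2).take (l.nodes + 1)) : FW (MvPolynomial (Fin 2) ℤ)) u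
            * (evalBT r ((p.1 ++ p.2).drop (l.nodes + 1)) : FW (MvPolynomial (Fin 2) ℤ)) v
        else 0)
        = if u.minimum = σ.minimum ∧ v.maximum = σ.maximum then
            (if admB l p.1 = true then (evalBT l p.1 : FW (MvPolynomial (Fin 2) ℤ)) u else 0)
            * (if admB r p.2 = true then (evalBT r p.2 : FW (MvPolynomial (Fin 2) ℤ)) v else 0)
          else 0 := by
      rintro ⟨x, y⟩ hp
      rw [Finset.mem_product, List.mem_toFinset, List.mem_toFinset, List.mem_permutations,
        List.mem_permutations] at hp
      have hxl : x.length = l.nodes + 1 := hp.1.length_eq.trans hu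
      have hxy : (x ++ y).Perm σ := (hp.1.append hp.2).trans h
      have h1 : (x ++ y).take (l.nodes + 1) = x := by rw [← hxl, List.take_left]
      have h2 : (x ++ y).drop (l.nodes + 1) = y := by rw [← hxl, List.drop_left]
      simp only [admB, h1, h2, hp.1.minimum_eq, hp.2.maximum_eq, hxy.minimum_eq, hxy.maximum_eq,
        Bool.and_eq_true, decide_eq_true_eq]
      split_ifs <;> simp_all
    rw [Finset.sum_congr rfl hterm]
    split_ifs <;> simp
  · intro w hw hn
    have hlen := hw.length_eq.trans h.length_eq.symm
    rw [List.length_append] at hlen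
    rw [hu] at hn
    split
    · by_contra hne
      refine hn ⟨(evalBT_perm ?_ (left_ne_zero_of_mul hne)).symm,
        (evalBT_perm ?_ (right_ne_zero_of_mul hne)).symm⟩
      · rw [List.length_take]; omega
      · rw [List.length_drop]; omega
    · rfl

theorem admCoeff_nd {l r : BT} {σ : List ℕ} (hσ : σ.length = l.nodes + r.nodes + 2) :
    admCoeff (.nd l r) σ
      = (if (σ.take (l.nodes + 1)).minimum = σ.minimum
            ∧ (σ.drop (l.nodes + 1)).maximum = σ.maximum then
          admCoeff l (σ.take (l.nodes + 1)) * admCoeff r (σ.drop (l.nodes + 1)) else 0)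
        - (if (σ.drop (r.nodes + 1)).minimum = σ.minimum
            ∧ (σ.take (r.nodes + 1)).maximum = σ.maximum then
          admCoeff l (σ.drop (r.nodes + 1)) * admCoeff r (σ.take (r.nodes + 1)) else 0) := by
  rw [← sum_admissible_nd (by rw [List.take_append_drop]) (by rw [List.length_take]; omega)
      (by rw [List.length_drop]; omega),
    ← sum_admissible_nd (u := σ.drop (r.nodes + 1)) (v := σ.take (r.nodes + 1))
      (List.perm_append_comm.trans (by rw [List.take_append_drop]))
      (by rw [List.length_drop]; omega) (by rw [List.length_take]; omega),
    ← Finset.sum_sub_distrib, admCoeff]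
  refine Finset.sum_congr rfl fun w hw => ?_
  have hw := List.mem_permutations.mp (List.mem_toFinset.mp hw)
  rw [evalBT_nd_apply (hw.length_eq.trans hσ)]
  split <;> simp

theorem BT.nodes_eq_zero {t : BT} : t.nodes = 0 ↔ t = .nil := by
  cases t <;> simp [BT.nodes]

theorem nodes_of_mem_allBT {m : ℕ} : ∀ {t : BT}, t ∈ allBT m → t.nodes = m := by
  induction m using Nat.strong_induction_on with
  | _ m ih =>
    intro t ht
    cases m with
    | zero => rw [allBT, Finset.mem_singleton] at ht; rw [ht, BT.nodes]
    | succ m =>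
      rw [allBT] at ht
      simp only [Finset.mem_biUnion, Finset.mem_image, Finset.mem_product] at ht
      obtain ⟨⟨k, hk⟩, -, ⟨l, r⟩, ⟨hl, hr⟩, rfl⟩ := ht
      have hk := Finset.mem_range.mp hk
      have hl := ih k hk hl
      have hr := ih (m - k) (by omega) hr
      simp only at hl hr
      rw [BT.nodes, hl, hr]
      omega

theorem sum_allBT_succ {M : Type*} [AddCommMonoid M] (m : ℕ) (f : BT → M) :
    ∑ t ∈ allBT (m + 1), f t
      = ∑ k ∈ Finset.range (m + 1), ∑ l ∈ allBT k, ∑ r ∈ allBT (m - k), f (.nd l r) := by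
  rw [allBT, Finset.sum_biUnion]
  · rw [← Finset.sum_attach (Finset.range (m + 1))]
    refine Finset.sum_congr rfl fun k _ => ?_
    rw [Finset.sum_image, Finset.sum_product]
    rintro ⟨l, r⟩ _ ⟨l', r'⟩ _ h
    simpa using h
  · intro k _ k' _ hkk
    rw [Function.onFun, Finset.disjoint_left]
    intro t ht ht'
    simp only [Finset.mem_image, Finset.mem_product] at ht ht'
    obtain ⟨⟨l, r⟩, ⟨hl, -⟩, rfl⟩ := ht
    obtain ⟨⟨l', r'⟩, ⟨hl', -⟩, h⟩ := ht'
    obtain ⟨rfl, rfl⟩ : l' = l ∧ r' = r := by simpa using h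
    exact hkk (Subtype.ext ((nodes_of_mem_allBT hl).symm.trans (nodes_of_mem_allBT hl')))

/-- The sequence of ascents (`true`) and descents (`false`) of a word. -/
def signSeq (σ : List ℕ) : List Bool := List.zipWith (fun x y => decide (x < y)) σ σ.tail

theorem length_signSeq (σ : List ℕ) : (signSeq σ).length = σ.length - 1 := by
  simp [signSeq]

theorem getElem_signSeq {σ : List ℕ} {i : ℕ} (h : i < (signSeq σ).length) :
    (signSeq σ)[i] = decide (σ[i]'(by rw [length_signSeq] at h; omega)
      < σ[i + 1]'(by rw [length_signSeq] at h; omega)) := by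
  simp [signSeq]

theorem signSeq_take (σ : List ℕ) (k : ℕ) :
    signSeq (σ.take (k + 1)) = (signSeq σ).take k := by
  apply List.ext_getElem
  · simp only [length_signSeq, List.length_take]; omega
  · intro i h1 h2
    simp [getElem_signSeq]

theorem signSeq_drop (σ : List ℕ) (k : ℕ) :
    signSeq (σ.drop k) = (signSeq σ).drop k := by
  apply List.ext_getElem
  · simp only [length_signSeq, List.length_drop]; omega
  · intro i h1 h2
    simp [getElem_signSeq, add_assoc]

/-- The coefficient of `σ` in the weighted sum over the trees with `m` nodes. -/
noncomputable def treeCoeff (m : ℕ) (σ : List ℕ) : MvPolynomial (Fin 2) ℤ :=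
  ∑ t ∈ allBT m, X 0 ^ rightE t * X 1 ^ leftE t * admCoeff t σ

theorem sum_allBT_nd (σ : List ℕ) {m k : ℕ} (hσ : σ.length = m + 2) (hk : k < m + 1) :
    ∑ l ∈ allBT k, ∑ r ∈ allBT (m - k),
      X 0 ^ rightE (.nd l r) * X 1 ^ leftE (.nd l r) * admCoeff (.nd l r) σ
    = (if k = 0 then 1 else X 1) * (if m - k = 0 then 1 else X 0)
      * ((if (σ.take (k + 1)).minimum = σ.minimum ∧ (σ.drop (k + 1)).maximum = σ.maximum then
          treeCoeff k (σ.take (k + 1)) * treeCoeff (m - k) (σ.drop (k + 1)) else 0)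
        - (if (σ.drop (m - k + 1)).minimum = σ.minimum
            ∧ (σ.take (m - k + 1)).maximum = σ.maximum then
          treeCoeff k (σ.drop (m - k + 1)) * treeCoeff (m - k) (σ.take (m - k + 1)) else 0)) := by
  simp only [treeCoeff, Finset.sum_mul_sum]
  simp only [← Finset.sum_product']
  have hterm : ∀ p ∈ allBT k ×ˢ allBT (m - k),
      X 0 ^ rightE (.nd p.1 p.2) * X 1 ^ leftE (.nd p.1 p.2) * admCoeff (.nd p.1 p.2) σ
      = (if k = 0 then 1 else X 1) * (if m - k = 0 then 1 else X 0)
        * ((if (σ.take (k + 1)).minimum = σ.minimum ∧ (σ.drop (k + 1)).maximum = σ.maximum then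
            X 0 ^ rightE p.1 * X 1 ^ leftE p.1 * admCoeff p.1 (σ.take (k + 1))
              * (X 0 ^ rightE p.2 * X 1 ^ leftE p.2 * admCoeff p.2 (σ.drop (k + 1))) else 0)
          - (if (σ.drop (m - k + 1)).minimum = σ.minimum
              ∧ (σ.take (m - k + 1)).maximum = σ.maximum then
            X 0 ^ rightE p.1 * X 1 ^ leftE p.1 * admCoeff p.1 (σ.drop (m - k + 1))
              * (X 0 ^ rightE p.2 * X 1 ^ leftE p.2 * admCoeff p.2 (σ.take (m - k + 1)))
            else 0)) := by
    rintro ⟨l, r⟩ hp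
    rw [Finset.mem_product] at hp
    have hl := nodes_of_mem_allBT hp.1
    have hr := nodes_of_mem_allBT hp.2
    simp only at hl hr
    have hl0 : l = .nil ↔ k = 0 := by rw [← BT.nodes_eq_zero, hl]
    have hr0 : r = .nil ↔ m - k = 0 := by rw [← BT.nodes_eq_zero, hr]
    simp only [rightE, leftE, hl0, hr0, pow_add, admCoeff_nd (l := l) (r := r) (σ := σ) (by omega),
      hl, hr]
    split_ifs <;> ring
  rw [Finset.sum_congr rfl hterm, ← Finset.mul_sum, Finset.sum_sub_distrib]
  split_ifs <;> simp

theorem minimum_eq_iff_mem {σ u : List ℕ} {a : ℕ} (ha : σ.minimum = WithTop.some a) (hu : u ⊆ σ) :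
    u.minimum = σ.minimum ↔ a ∈ u := by
  rw [ha, List.minimum_eq_coe_iff]
  exact ⟨fun h => h.1, fun h => ⟨h, fun b hb => (List.minimum_eq_coe_iff.mp ha).2 b (hu hb)⟩⟩

theorem maximum_eq_iff_mem {σ u : List ℕ} {a : ℕ} (ha : σ.maximum = WithBot.some a) (hu : u ⊆ σ) :
    u.maximum = σ.maximum ↔ a ∈ u := by
  rw [ha, List.maximum_eq_coe_iff]
  exact ⟨fun h => h.1, fun h => ⟨h, fun b hb => (List.maximum_eq_coe_iff.mp ha).2 b (hu hb)⟩⟩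

theorem mem_drop_iff_le_idxOf {σ : List ℕ} (hσ : σ.Nodup) {a : ℕ} (ha : a ∈ σ) (k : ℕ) :
    a ∈ σ.drop k ↔ k ≤ σ.idxOf a := by
  have h1 := List.mem_take_iff_idxOf_lt (n := k) ha
  have h2 : a ∈ σ.take k ∨ a ∈ σ.drop k := by
    rw [← List.mem_append, List.take_append_drop]; exact ha
  have h3 : ¬(a ∈ σ.take k ∧ a ∈ σ.drop k) := fun h => by
    rw [← List.take_append_drop k σ] at hσ
    exact List.disjoint_of_nodup_append hσ h.1 h.2
  rw [← not_lt, ← h1]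
  tauto

theorem extW_signSeq {x : MvPolynomial (Fin 2) ℤ} {u : List ℕ} {k : ℕ} (hu : u.length = k + 1) :
    extW x (signSeq u) = (if k = 0 then 1 else x) * signedW (signSeq u) := by
  have h : signSeq u = [] ↔ k = 0 := by
    rw [← List.length_eq_zero_iff, length_signSeq, hu]; omega
  rw [extW]
  by_cases hk : k = 0
  · rw [if_pos (h.mpr hk), if_pos hk, h.mpr hk, signedW_nil, one_mul]
  · rw [if_neg (mt h.mp hk), if_neg hk]

theorem treeCoeff_eq (m : ℕ) : ∀ {σ : List ℕ}, σ.length = m + 1 → σ.Nodup →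
    treeCoeff m σ = signedW (signSeq σ) := by
  induction m using Nat.strong_induction_on with
  | _ m ih =>
  intro σ hσ hnd
  cases m with
  | zero =>
    obtain ⟨x, rfl⟩ := List.length_eq_one_iff.mp hσ
    have : signSeq [x] = [] := by simp [signSeq]
    rw [this, signedW_nil]
    have hperm : [x].permutations = [[x]] := by simp [List.permutations]
    simp [treeCoeff, allBT, admCoeff, admB, evalBT, rightE, leftE, hperm]
  | succ m =>
    have hne : σ ≠ [] := by rintro rfl; simp at hσ
    obtain ⟨a, ha⟩ := WithTop.ne_top_iff_exists.mp (List.minimum_ne_top_of_ne_nil hne)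
    obtain ⟨b, hb⟩ := WithBot.ne_bot_iff_exists.mp (List.maximum_ne_bot_of_ne_nil hne)
    have ha' := List.minimum_eq_coe_iff.mp ha.symm
    have hb' := List.maximum_eq_coe_iff.mp hb.symm
    set p := σ.idxOf a with hp
    set q := σ.idxOf b with hq
    have hpl : p < m + 2 := by rw [hp, ← hσ]; exact List.idxOf_lt_length_of_mem ha'.1
    have hql : q < m + 2 := by rw [hq, ← hσ]; exact List.idxOf_lt_length_of_mem hb'.1
    have hpa : σ[p] = a := List.getElem_idxOf _
    have hqb : σ[q] = b := List.getElem_idxOf _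
    have hlen : (signSeq σ).length = m + 1 := by rw [length_signSeq, hσ]; rfl
    have hmin : ∀ i (h : i < σ.length), i ≠ p → σ[p] < σ[i] := fun i h hi =>
      lt_of_le_of_ne (by rw [hpa]; exact ha'.2 _ (List.getElem_mem h))
        fun e => hi ((hnd.getElem_inj_iff).mp e).symm
    have hmax : ∀ i (h : i < σ.length), i ≠ q → σ[i] < σ[q] := fun i h hi =>
      lt_of_le_of_ne (by rw [hqb]; exact hb'.2 _ (List.getElem_mem h))
        fun e => hi ((hnd.getElem_inj_iff).mp e)
    have sp : p ≠ m + 1 → (signSeq σ)[p]? = some true := fun h => by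
      rw [List.getElem?_eq_getElem (by omega), getElem_signSeq]
      simpa using hmin (p + 1) (by omega) (by omega)
    have sp' : p ≠ 0 → (signSeq σ)[p - 1]? = some false := fun h => by
      have := hmin (p - 1) (by omega) (by omega)
      rw [List.getElem?_eq_getElem (by omega), getElem_signSeq]
      simpa [Nat.sub_add_cancel (Nat.pos_of_ne_zero h)] using this.le
    have sq : q ≠ m + 1 → (signSeq σ)[q]? = some false := fun h => by
      rw [List.getElem?_eq_getElem (by omega), getElem_signSeq]
      simpa using (hmax (q + 1) (by omega) (by omega)).le
    have sq' : q ≠ 0 → (signSeq σ)[q - 1]? = some true := fun h => by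
      have := hmax (q - 1) (by omega) (by omega)
      rw [List.getElem?_eq_getElem (by omega), getElem_signSeq]
      simpa [Nat.sub_add_cancel (Nat.pos_of_ne_zero h)] using this
    have hpq : p ≠ q := by
      intro h
      have h1 := hmin (if p = 0 then 1 else 0) (by split <;> omega) (by split <;> omega)
      have h2 := hmax (if p = 0 then 1 else 0) (by split <;> omega) (by split <;> omega)
      simp only [← h] at h2
      exact absurd h1 h2.not_gt
    have cut : ∀ c : Bool, ∀ j < m + 1, cutTerm c (signSeq σ) j
        = (if j = 0 then 1 else signVar (!c)) * (if m - j = 0 then 1 else signVar c)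
          * (treeCoeff j (σ.take (j + 1)) * treeCoeff (m - j) (σ.drop (j + 1))) := by
      intro c j hj
      have l1 : (σ.take (j + 1)).length = j + 1 := by rw [List.length_take]; omega
      have l2 : (σ.drop (j + 1)).length = m - j + 1 := by rw [List.length_drop]; omega
      rw [cutTerm, ← signSeq_take, ← signSeq_drop, extW_signSeq l1, extW_signSeq l2,
        ih j (by omega) l1 (hnd.sublist (List.take_sublist _ _)),
        ih (m - j) (by omega) l2 (hnd.sublist (List.drop_sublist _ _))]
      ring
    have expand : treeCoeff (m + 1) σ
        = ∑ j ∈ Finset.range (m + 1),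
            (if j ∈ Finset.Ico p q then cutTerm true (signSeq σ) j else 0)
          - ∑ j ∈ Finset.range (m + 1),
            (if j ∈ Finset.Ico q p then cutTerm false (signSeq σ) j else 0) := by
      rw [treeCoeff, sum_allBT_succ, ← Finset.sum_range_reflect (fun j =>
        if j ∈ Finset.Ico q p then cutTerm false (signSeq σ) j else 0), ← Finset.sum_sub_distrib]
      refine Finset.sum_congr rfl fun k hk => ?_
      have hk := Finset.mem_range.mp hk
      rw [sum_allBT_nd σ hσ hk]
      simp only [minimum_eq_iff_mem ha.symm (List.take_subset _ _),
        minimum_eq_iff_mem ha.symm (List.drop_subset _ _),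
        maximum_eq_iff_mem hb.symm (List.take_subset _ _),
        maximum_eq_iff_mem hb.symm (List.drop_subset _ _),
        List.mem_take_iff_idxOf_lt ha'.1, List.mem_take_iff_idxOf_lt hb'.1,
        mem_drop_iff_le_idxOf hnd ha'.1, mem_drop_iff_le_idxOf hnd hb'.1, ← hp, ← hq]
      rw [cut true k hk, cut false (m + 1 - 1 - k) (by omega)]
      have e1 : m - (m - k) = k := by omega
      have c1 : (p < k + 1 ∧ k + 1 ≤ q) ↔ k ∈ Finset.Ico p q := by rw [Finset.mem_Ico]; omega
      have c2 : (m - k + 1 ≤ p ∧ q < m - k + 1) ↔ m - k ∈ Finset.Ico q p := by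
        rw [Finset.mem_Ico]; omega
      simp only [c1, c2, Nat.add_sub_cancel, e1, signVar, Bool.not_true, Bool.not_false, if_true,
        Bool.false_eq_true, if_false]
      rw [mul_sub, mul_ite_zero, mul_ite_zero]
      congr 2
      ring
    rw [expand, Finset.sum_ite_mem, Finset.sum_ite_mem,
      Finset.inter_eq_right.mpr fun j hj =>
        Finset.mem_range.mpr (by have := Finset.mem_Ico.mp hj; omega),
      Finset.inter_eq_right.mpr fun j hj =>
        Finset.mem_range.mpr (by have := Finset.mem_Ico.mp hj; omega)]
    rcases lt_or_gt_of_ne hpq with h | h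
    · rw [Finset.Ico_eq_empty_of_le h.le,
        sum_cutTerm_Ico h (by omega) (sp (by omega)) sp' (sq' (by omega))
          fun hh => sq (by omega)]
      simp [signUnit]
    · rw [Finset.Ico_eq_empty_of_le h.le,
        sum_cutTerm_Ico h (by omega) (sq (by omega)) sq' (sp' (by omega))
          fun hh => sp (by omega)]
      simp [signUnit]

theorem esetOf_injective {L L' : List Bool} (hlen : L.length = L'.length)
    (h : esetOf L = esetOf L') : L = L' := by
  apply List.ext_getElem hlen
  intro i h1 h2
  have := Finset.ext_iff.mp h (i + 1)
  simpa [esetOf, h1, h2] using this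

theorem card_esetOf (L : List Bool) : (esetOf L).card = L.count false := by
  have h : (esetOf L).card
      = ∑ i ∈ Finset.range L.length, if L.getD i true = false then 1 else 0 := by
    rw [esetOf, Finset.card_filter]
    refine Finset.sum_nbij' (fun i => i - 1) (fun i => i + 1) ?_ ?_ ?_ ?_ fun _ _ => rfl
    all_goals
      intro i hi
      simp only [Finset.mem_Icc, Finset.mem_range] at hi ⊢
      omega
  rw [h]
  clear h
  induction L with
  | nil => simp
  | cons x L ih =>
    rw [List.length_cons, Finset.sum_range_succ', List.count_cons]
    simp only [List.getD_cons_succ, List.getD_cons_zero, ih]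
    cases x <;> simp

theorem desSet_eq {σ : List ℕ} (hσ : σ.Nodup) : desSet σ = esetOf (signSeq σ) := by
  ext i
  simp only [desSet, esetOf, Finset.mem_filter, Finset.mem_Icc, length_signSeq]
  refine and_congr_right fun hi => ?_
  obtain ⟨j, rfl⟩ : ∃ j, i = j + 1 := ⟨i - 1, by omega⟩
  have hj : j < (signSeq σ).length := by rw [length_signSeq]; omega
  have h1 : j < σ.length := by omega
  have h2 : j + 1 < σ.length := by omega
  have hne : σ[j] ≠ σ[j + 1] := fun e => by simpa using (hσ.getElem_inj_iff).mp e
  simp only [Nat.add_sub_cancel, List.getD_eq_getElem _ _ hj, List.getD_eq_getElem _ _ h1,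
    List.getD_eq_getElem _ _ h2, getElem_signSeq, decide_eq_false_iff_not]
  omega

theorem mem_permWords {n : ℕ} {σ : List ℕ} : σ ∈ permWords n ↔ σ.Perm (List.range' 1 n) := by
  rw [permWords, List.mem_toFinset, List.mem_permutations]

theorem permWords_eq {n : ℕ} {σ : List ℕ} (h : σ ∈ permWords n) :
    permWords n = σ.permutations.toFinset := by
  ext w
  rw [mem_permWords, List.mem_toFinset, List.mem_permutations]
  rw [mem_permWords] at h
  exact ⟨fun hw => hw.trans h.symm, fun hw => hw.trans h⟩

theorem DCat_apply (n : ℕ) (σ : List ℕ) :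
    DCat n σ = if σ ∈ permWords n then signedW (signSeq σ) else 0 := by
  have hterm : ∀ f : Fin (n - 1) → Bool,
      ((wEps (List.ofFn f) * (-1) ^ (esetOf (List.ofFn f)).card) •
        ∑ τ ∈ (permWords n).filter (fun τ => desSet τ = esetOf (List.ofFn f)),
          Finsupp.single τ (1 : MvPolynomial (Fin 2) ℤ)) σ
      = if σ ∈ permWords n ∧ desSet σ = esetOf (List.ofFn f) then signedW (List.ofFn f) else 0 := by
    intro f
    rw [Finsupp.smul_apply, Finsupp.finsetSum_apply]
    simp only [Finsupp.single_apply, Finset.sum_ite_eq', Finset.mem_filter, signedW, card_esetOf]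
    split_ifs <;> simp [mul_comm]
  rw [DCat, Finsupp.finsetSum_apply, Finset.sum_congr rfl fun f _ => hterm f]
  split_ifs with h
  · have hp := mem_permWords.mp h
    have hnd : σ.Nodup := hp.nodup_iff.mpr (List.nodup_range')
    have hlen : (signSeq σ).length = n - 1 := by
      rw [length_signSeq, hp.length_eq, List.length_range']
    rw [desSet_eq hnd, Finset.sum_eq_single fun i => (signSeq σ)[i]'(by omega)]
    · have : List.ofFn (fun i : Fin (n - 1) => (signSeq σ)[i]'(by omega)) = signSeq σ := by
        apply List.ext_getElem <;> simp [hlen]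
      rw [this, if_pos ⟨h, rfl⟩]
    · intro f _ hf
      rw [if_neg]
      rintro ⟨-, he⟩
      have := esetOf_injective (by simp [hlen]) he
      refine hf (funext fun i => ?_)
      simp [this]
    · simp
  · simp [h]

theorem stmt13 : ∀ n : ℕ, 2 ≤ n →
    DCat n = ∑ t ∈ allBT (n - 1),
      ∑ w ∈ (permWords n).filter (fun w => admB t w = true),
        (X 0 ^ rightE t * X 1 ^ leftE t : MvPolynomial (Fin 2) ℤ) • evalBT t w := by
  intro n hn
  ext1 σ
  rw [DCat_apply, Finsupp.finsetSum_apply]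
  simp only [Finsupp.finsetSum_apply, Finsupp.smul_apply, smul_eq_mul]
  split_ifs with h
  · have hp := mem_permWords.mp h
    rw [← treeCoeff_eq (n - 1) (by rw [hp.length_eq, List.length_range']; omega)
      (hp.nodup_iff.mpr List.nodup_range'), treeCoeff]
    refine Finset.sum_congr rfl fun t _ => ?_
    rw [permWords_eq h, admCoeff, Finset.sum_filter, Finset.mul_sum]
    refine Finset.sum_congr rfl fun w _ => ?_
    split <;> simp
  · symm
    refine Finset.sum_eq_zero fun t ht => Finset.sum_eq_zero fun w hw => ?_
    have hw := mem_permWords.mp (Finset.mem_filter.mp hw).1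
    have ht := nodes_of_mem_allBT ht
    by_contra hne
    refine h (mem_permWords.mpr ((evalBT_perm ?_ (right_ne_zero_of_mul hne)).trans hw))
    rw [hw.length_eq, List.length_range']
    omega
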